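/- arXiv:1201.0941 — 2 statements merged into one kernel-verified Lean document; each statement's English description precedes it below -/
import Mathlib

section
/- There exists a measurable set S ⊆ (0,1) with λ(S) ≥ 1/40 such that for every α ∈ S, the series Σ_{n ≥ 2, α ∈ W_n} 1/(n·log n) diverges, where W_n = {α ∈ (0,1) irrational : Σ_{i=1}^{n} a_i(α) < 10·n·log n}. -/
open MeasureTheory Filter Set
open scoped ENNReal

noncomputable def gaussMap (x : ℝ) : ℝ := Int.fract (1 / x)

/-- The `n`-th continued fraction partial quotient of `α` (for `n ≥ 1`). -/
noncomputable def cfA (α : ℝ) (n : ℕ) : ℕ := ⌊1 / (gaussMap^[n - 1] α)⌋₊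

/-- `W n` : the set of irrationals `α ∈ (0,1)` with `Σ_{i=1}^n a_i(α) < 10 n log n`. -/
def Wset (n : ℕ) : Set ℝ :=
  {α | α ∈ Set.Ioo (0:ℝ) 1 ∧ Irrational α ∧
    (∑ i ∈ Finset.Icc 1 n, (cfA α i : ℝ)) < 10 * n * Real.log n}

noncomputable def hG (x : ℝ) : ℝ≥0∞ := ENNReal.ofReal (1 / (1 + x))
noncomputable def nuG : Measure ℝ := (volume.restrict (Ioo (0:ℝ) 1)).withDensity hG

lemma hG_meas : Measurable hG := by unfold hG; fun_prop
lemma gaussMap_meas : Measurable gaussMap := by unfold gaussMap; fun_prop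

lemma tsum_tele (y : ℝ) (hy : 0 ≤ y) :
    ∑' k : ℕ, ENNReal.ofReal (1 / ((k + 1 + y) * (k + 1 + y + 1))) = hG y := by
  have h : HasSum (fun k : ℕ => 1 / ((k + 1 + y) * (k + 1 + y + 1))) (1 / (1 + y)) := by
    rw [hasSum_iff_tendsto_nat_of_nonneg (fun k => by positivity)]
    have e : ∀ n : ℕ, ∑ k ∈ Finset.range n, 1 / (((k:ℝ) + 1 + y) * (k + 1 + y + 1))
        = 1 / (1 + y) - 1 / (n + 1 + y) := by
      intro n
      induction n with
      | zero => simp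
      | succ n ih =>
        rw [Finset.sum_range_succ, ih]; push_cast
        have : (n:ℝ) + 1 + y ≠ 0 := by positivity
        have : (n:ℝ) + 1 + 1 + y ≠ 0 := by positivity
        have : (n:ℝ) + 1 + y + 1 ≠ 0 := by positivity
        have : 1 + y ≠ 0 := by positivity
        field_simp
        ring
    simp_rw [e]
    have : Tendsto (fun n : ℕ => 1 / ((n:ℝ) + 1 + y)) atTop (nhds 0) := by
      simp_rw [one_div]
      apply tendsto_inv_atTop_zero.comp
      simp_rw [add_assoc]
      exact tendsto_atTop_add_const_right _ _ tendsto_natCast_atTop_atTop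
    simpa using tendsto_const_nhds.sub this
  rw [hG, ← h.tsum_eq, ENNReal.ofReal_tsum_of_nonneg (fun k => by positivity) h.summable]

lemma cover : Ioo (0:ℝ) 1 ⊆ ⋃ k : ℕ, (fun y : ℝ => 1 / (k + 1 + y)) '' Ico 0 1 := by
  intro x ⟨h0, h1⟩
  have h2 : 1 ≤ 1 / x := by rw [le_div_iff₀ h0]; linarith
  have h3 : 1 ≤ ⌊1 / x⌋₊ := Nat.le_floor (by simpa using h2)
  obtain ⟨k, hk⟩ := Nat.exists_eq_add_of_le' h3
  have h4 := Nat.floor_le (zero_le_one.trans h2)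
  have h5 := Nat.lt_floor_add_one (1 / x)
  rw [hk] at h4 h5
  push_cast at h4 h5
  refine mem_iUnion.2 ⟨k, 1 / x - (k + 1), ⟨by linarith, by linarith⟩, ?_⟩
  simp

lemma inv_step (g : ℝ → ℝ≥0∞) (hg : Measurable g) :
    ∫⁻ x, g (gaussMap x) ∂nuG ≤ ∫⁻ x, g x ∂nuG := by
  unfold nuG
  rw [lintegral_withDensity_eq_lintegral_mul _ hG_meas (show Measurable fun x => g (gaussMap x) from hg.comp gaussMap_meas),
    lintegral_withDensity_eq_lintegral_mul _ hG_meas hg]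
  calc _ ≤ ∫⁻ x in ⋃ k : ℕ, (fun y : ℝ => 1 / (k + 1 + y)) '' Ico 0 1,
        (hG * fun x => g (gaussMap x)) x := lintegral_mono_set cover
    _ ≤ ∑' k : ℕ, ∫⁻ x in (fun y : ℝ => 1 / (k + 1 + y)) '' Ico 0 1,
        (hG * fun x => g (gaussMap x)) x := lintegral_iUnion_le _ _
    _ = ∑' k : ℕ, ∫⁻ y in Ico (0:ℝ) 1,
          ENNReal.ofReal (1 / ((k + 1 + y) * (k + 1 + y + 1))) * g y := by
        congr 1; ext k
        rw [lintegral_image_eq_lintegral_abs_deriv_mul (f' := fun y => -1 / (k + 1 + y) ^ 2) measurableSet_Ico]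
        · apply setLIntegral_congr_fun measurableSet_Ico
          intro y hy
          have hy0 := hy.1
          have e1 : gaussMap (1 / (k + 1 + y)) = y := by
            unfold gaussMap
            rw [one_div_one_div, show (k:ℝ) + 1 + y = y + ((k + 1 : ℕ) : ℝ) by push_cast; ring,
              Int.fract_add_natCast, Int.fract_eq_self.2 hy]
          simp only [Pi.mul_apply, e1, hG, ← mul_assoc]
          rw [← ENNReal.ofReal_mul (abs_nonneg _)]
          congr 2
          have p : (0:ℝ) < k + 1 + y := by positivity
          rw [neg_div, abs_neg, abs_of_pos (by positivity)]
          field_simp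
        · intro y hy
          have hy0 := hy.1
          have p : (k:ℝ) + 1 + y ≠ 0 := by positivity
          have h5 : HasDerivAt (fun z : ℝ => (k:ℝ) + 1 + z) 1 y :=
            (hasDerivAt_id' y).const_add ((k:ℝ) + 1)
          have h6 := (h5.fun_inv p).hasDerivWithinAt (s := Ico (0:ℝ) 1)
          simp only [one_div]
          exact h6
        · intro a ha b hb hab
          simp only [one_div, inv_inj] at hab
          linarith
    _ = ∫⁻ y in Ico (0:ℝ) 1, hG y * g y := by
        rw [← lintegral_tsum (fun k => by fun_prop)]
        apply setLIntegral_congr_fun measurableSet_Ico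
        intro y hy
        simp only
        rw [ENNReal.tsum_mul_right, tsum_tele y hy.1]
    _ = _ := setLIntegral_congr Ioo_ae_eq_Ico.symm

lemma inv_iter (g : ℝ → ℝ≥0∞) (hg : Measurable g) (n : ℕ) :
    ∫⁻ x, g (gaussMap^[n] x) ∂nuG ≤ ∫⁻ x, g x ∂nuG := by
  induction n with
  | zero => simp
  | succ n ih =>
    simp_rw [Function.iterate_succ_apply]
    exact (inv_step (fun x => g (gaussMap^[n] x)) (hg.comp (gaussMap_meas.iterate n))).trans ih

lemma nuG_le : nuG ≤ volume.restrict (Ioo (0:ℝ) 1) := by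
  have h : nuG ≤ (volume.restrict (Ioo (0:ℝ) 1)).withDensity 1 := by
    apply withDensity_mono
    filter_upwards [ae_restrict_mem measurableSet_Ioo] with x hx
    have h0 := hx.1
    simp only [hG, Pi.one_apply, ENNReal.ofReal_le_one]
    rw [div_le_one (by linarith)]
    linarith
  rwa [withDensity_one] at h

lemma nuG_ge : ENNReal.ofReal (1 / 2) ≤ nuG univ := by
  unfold nuG
  rw [withDensity_apply _ MeasurableSet.univ, Measure.restrict_univ]
  calc ENNReal.ofReal (1 / 2) = ∫⁻ x in Ioo (0:ℝ) 1, ENNReal.ofReal (1 / 2) := by simp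
    _ ≤ _ := by
      apply setLIntegral_mono' measurableSet_Ioo
      intro x hx
      have h0 := hx.1
      have h1 := hx.2
      apply ENNReal.ofReal_le_ofReal
      apply one_div_le_one_div_of_le <;> linarith

lemma nuG_le_one : nuG univ ≤ 1 := (nuG_le univ).trans (by simp)

instance : IsFiniteMeasure nuG := ⟨nuG_le_one.trans_lt (by simp)⟩

lemma nuG_small (i : ℕ) (t : ℝ) : nuG {x | gaussMap^[i] x ≤ t} ≤ ENNReal.ofReal t := by
  have hm : MeasurableSet {x : ℝ | x ≤ t} := measurableSet_Iic
  have h := inv_iter (indicator {x : ℝ | x ≤ t} 1) (measurable_one.indicator hm) i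
  rw [lintegral_indicator_one hm] at h
  have e : (fun x => indicator {x : ℝ | x ≤ t} (1 : ℝ → ℝ≥0∞) (gaussMap^[i] x))
      = indicator {x | gaussMap^[i] x ≤ t} 1 := by
    ext x; simp [indicator]
  have hm2 : MeasurableSet {x | gaussMap^[i] x ≤ t} := (gaussMap_meas.iterate i) hm
  rw [e, lintegral_indicator_one hm2] at h
  refine h.trans ((nuG_le _).trans ?_)
  rw [Measure.restrict_apply hm]
  calc _ ≤ volume (Icc 0 t) := measure_mono (fun x hx => ⟨hx.2.1.le, hx.1⟩)
    _ = _ := by simp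

noncomputable def gM (t : ℝ) : ℝ → ℝ≥0∞ := indicator (Ioi t) (fun x => ENNReal.ofReal (1 / x))

lemma gM_meas (t : ℝ) : Measurable (gM t) :=
  Measurable.indicator (by fun_prop) measurableSet_Ioi

lemma gM_int (i : ℕ) (t : ℝ) (h0 : 0 < t) (h1 : t ≤ 1) :
    ∫⁻ x, gM t (gaussMap^[i] x) ∂nuG ≤ ENNReal.ofReal (Real.log (1 / t)) := by
  refine (inv_iter _ (gM_meas t) i).trans ((lintegral_mono' nuG_le le_rfl).trans ?_)
  unfold gM
  rw [lintegral_indicator measurableSet_Ioi, Measure.restrict_restrict measurableSet_Ioi]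
  calc _ ≤ ∫⁻ x in Ioc t 1, ENNReal.ofReal (1 / x) :=
        lintegral_mono_set (fun x hx => ⟨hx.1, hx.2.2.le⟩)
    _ = ENNReal.ofReal (∫ x in Ioc t 1, 1 / x) := by
        rw [ofReal_integral_eq_lintegral_ofReal]
        · refine (intervalIntegrable_iff_integrableOn_Ioc_of_le h1).1 ?_
          apply intervalIntegral.intervalIntegrable_one_div
          · intro x hx
            rw [uIcc_of_le h1] at hx
            linarith [hx.1]
          · fun_prop
        · filter_upwards [ae_restrict_mem measurableSet_Ioc] with x hx
          have : 0 < x := h0.trans hx.1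
          positivity
    _ = _ := by
        rw [← intervalIntegral.integral_of_le h1, integral_one_div_of_pos h0 one_pos]

lemma Wset_meas (n : ℕ) : MeasurableSet (Wset n) := by
  have h1 : MeasurableSet {x : ℝ | Irrational x} :=
    (countable_range ((↑) : ℚ → ℝ)).measurableSet.compl
  have h2 : ∀ i, Measurable fun α => (cfA α i : ℝ) := by
    intro i
    unfold cfA
    have := gaussMap_meas.iterate (i - 1)
    exact measurable_from_nat.comp (Nat.measurable_floor.comp (measurable_const.div this))
  have h3 : Measurable fun α => ∑ i ∈ Finset.Icc 1 n, (cfA α i : ℝ) :=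
    Finset.measurable_sum _ (fun i _ => h2 i)
  exact measurableSet_Ioo.inter (h1.inter (measurableSet_lt h3 measurable_const))

lemma W_compl_subset (n : ℕ) (t : ℝ) (h0 : 0 < t) :
    (Wset n)ᶜ ⊆ (Ioo (0:ℝ) 1)ᶜ ∪ range ((↑) : ℚ → ℝ) ∪
      ((⋃ i ∈ Finset.range n, {x | gaussMap^[i] x ≤ t}) ∪
      {x | ENNReal.ofReal (10 * n * Real.log n) ≤ ∑ i ∈ Finset.range n, gM t (gaussMap^[i] x)}) := by
  intro x hx
  by_contra hc
  simp only [mem_union, not_or, mem_compl_iff, not_not] at hc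
  obtain ⟨⟨hI, hirr⟩, h2, h3⟩ := hc
  apply hx
  refine ⟨hI, hirr, ?_⟩
  simp only [mem_iUnion, not_exists, mem_ofPred_eq, not_le] at h2 h3
  by_contra h4
  push Not at h4
  apply absurd h3
  push Not
  have e : ∑ i ∈ Finset.range n, gM t (gaussMap^[i] x)
      = ENNReal.ofReal (∑ i ∈ Finset.range n, 1 / (gaussMap^[i] x)) := by
    rw [ENNReal.ofReal_sum_of_nonneg]
    · apply Finset.sum_congr rfl
      intro i hi
      exact indicator_of_mem (h2 i hi) _
    · intro i hi
      have := h0.trans (h2 i hi)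
      positivity
  rw [e]
  apply ENNReal.ofReal_le_ofReal
  refine h4.trans ?_
  rw [← Finset.Ico_succ_right_eq_Icc, Finset.sum_Ico_eq_sum_range]
  apply Finset.sum_le_sum
  intro i hi
  have := h0.trans (h2 i (by simpa using hi))
  simp only [cfA, Nat.add_sub_cancel_left]
  exact Nat.floor_le (by positivity)

lemma nuG_compl (n : ℕ) (hn : 10 ≤ n) : nuG (Wset n)ᶜ ≤ ENNReal.ofReal (3 / 10) := by
  have hn' : (10:ℝ) ≤ n := by exact_mod_cast hn
  set t : ℝ := 1 / (n:ℝ) ^ 2 with ht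
  have h0 : 0 < t := by positivity
  have h1 : t ≤ 1 := by
    rw [ht, div_le_one (by positivity)]; nlinarith
  have hlog : 0 < Real.log n := Real.log_pos (by linarith)
  have hc : (0:ℝ) < 10 * n * Real.log n := by positivity
  refine (measure_mono (W_compl_subset n t h0)).trans ?_
  have z1 : nuG (Ioo (0:ℝ) 1)ᶜ = 0 := by
    apply le_antisymm _ (zero_le)
    refine (nuG_le _).trans ?_
    rw [Measure.restrict_apply measurableSet_Ioo.compl]
    simp
  have z2 : nuG (range ((↑) : ℚ → ℝ)) = 0 := by
    apply le_antisymm _ (zero_le)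
    refine (nuG_le _).trans ((Measure.restrict_apply_le _ _).trans ?_)
    exact ((countable_range ((↑) : ℚ → ℝ)).measure_zero _).le
  have z : nuG ((Ioo (0:ℝ) 1)ᶜ ∪ range ((↑) : ℚ → ℝ)) ≤ 0 :=
    (measure_union_le _ _).trans (by simp [z1, z2])
  have b1 : nuG (⋃ i ∈ Finset.range n, {x | gaussMap^[i] x ≤ t}) ≤ ENNReal.ofReal (1 / 10) := by
    refine (measure_biUnion_finset_le _ _).trans
      ((Finset.sum_le_sum (fun i _ => nuG_small i t)).trans ?_)
    rw [← ENNReal.ofReal_sum_of_nonneg (fun _ _ => h0.le)]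
    apply ENNReal.ofReal_le_ofReal
    rw [Finset.sum_const, Finset.card_range, nsmul_eq_mul, ht]
    rw [mul_one_div, div_le_div_iff₀ (by positivity) (by norm_num)]
    nlinarith
  have b2 : nuG {x | ENNReal.ofReal (10 * n * Real.log n)
      ≤ ∑ i ∈ Finset.range n, gM t (gaussMap^[i] x)} ≤ ENNReal.ofReal (2 / 10) := by
    have hm : ∀ i ∈ Finset.range n, Measurable fun x => gM t (gaussMap^[i] x) :=
      fun i _ => (gM_meas t).comp (gaussMap_meas.iterate i)
    refine (meas_ge_le_lintegral_div (Finset.measurable_fun_sum _ hm).aemeasurable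
      (ENNReal.ofReal_pos.2 hc).ne' ENNReal.ofReal_ne_top).trans ?_
    rw [lintegral_finsetSum _ hm]
    refine (ENNReal.div_le_div_right
      (Finset.sum_le_sum (fun i _ => gM_int i t h0 h1)) _).trans ?_
    have hl : Real.log (1 / t) = 2 * Real.log n := by
      rw [ht, one_div_one_div, Real.log_pow]; norm_num
    rw [hl, ← ENNReal.ofReal_sum_of_nonneg (fun _ _ => by positivity),
      ← ENNReal.ofReal_div_of_pos hc]
    apply ENNReal.ofReal_le_ofReal
    rw [Finset.sum_const, Finset.card_range, nsmul_eq_mul]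
    apply le_of_eq
    field_simp
  refine (measure_union_le _ _).trans ?_
  refine (add_le_add z ((measure_union_le _ _).trans (add_le_add b1 b2))).trans ?_
  rw [zero_add, ← ENNReal.ofReal_add (by norm_num) (by norm_num)]
  norm_num

lemma nuG_W (n : ℕ) (hn : 10 ≤ n) : 1 / 5 ≤ nuG.real (Wset n) := by
  have h1 := measureReal_add_measureReal_compl (μ := nuG) (Wset_meas n)
  have h2 : nuG.real (Wset n)ᶜ ≤ 3 / 10 :=
    ENNReal.toReal_le_of_le_ofReal (by norm_num) (nuG_compl n hn)
  have h3 : 1 / 2 ≤ nuG.real univ :=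
    (ENNReal.ofReal_le_iff_le_toReal (measure_ne_top _ _)).1 nuG_ge
  linarith

lemma diverge_lemma {X : Type*} [MeasurableSpace X] (μ : Measure X) [IsFiniteMeasure μ]
    (hμ : μ univ ≤ 1) (A : ℕ → Set X) (hA : ∀ n, MeasurableSet (A n)) (w : ℕ → ℝ)
    (hw : ∀ n, 0 ≤ w n) (hs : ¬ Summable w) (c : ℝ) (hc0 : 0 ≤ c) (hc : ∀ n, c ≤ μ.real (A n)) :
    MeasurableSet {x | ∑' n, (A n).indicator (fun _ => ENNReal.ofReal (w n)) x = ⊤} ∧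
    ENNReal.ofReal c ≤ μ {x | ∑' n, (A n).indicator (fun _ => ENNReal.ofReal (w n)) x = ⊤} := by
  set F : X → ℝ≥0∞ := fun x => ∑' n, (A n).indicator (fun _ => ENNReal.ofReal (w n)) x with hF
  have hmi : ∀ n, Measurable ((A n).indicator (fun _ => ENNReal.ofReal (w n))) :=
    fun n => measurable_const.indicator (hA n)
  have hFm : Measurable F := Measurable.ennreal_tsum hmi
  have hgt : ∀ K : ℕ, MeasurableSet {x | (K : ℝ≥0∞) < F x} :=
    fun K => measurableSet_lt measurable_const hFm
  have key : ∀ K : ℕ, c ≤ μ.real {x | (K : ℝ≥0∞) < F x} := by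
    intro K
    by_contra hlt
    push Not at hlt
    set B := {x | (K : ℝ≥0∞) < F x} with hB
    set p := μ.real B
    have hp0 : 0 ≤ p := measureReal_nonneg
    have hb : ∀ N, (c - p) * ∑ n ∈ Finset.range N, w n ≤ K := by
      intro N
      set V := ∑ n ∈ Finset.range N, w n with hV
      have hV0 : 0 ≤ V := Finset.sum_nonneg (fun n _ => hw n)
      have e1 : ENNReal.ofReal (V * c) ≤ ENNReal.ofReal (K + V * p) := by
        calc ENNReal.ofReal (V * c) ≤ ENNReal.ofReal (∑ n ∈ Finset.range N, w n * μ.real (A n)) := by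
              apply ENNReal.ofReal_le_ofReal
              rw [hV, Finset.sum_mul]
              exact Finset.sum_le_sum fun n _ => mul_le_mul_of_nonneg_left (hc n) (hw n)
          _ = ∑ n ∈ Finset.range N, ∫⁻ x, (A n).indicator (fun _ => ENNReal.ofReal (w n)) x ∂μ := by
              rw [ENNReal.ofReal_sum_of_nonneg (fun n _ => mul_nonneg (hw n) measureReal_nonneg)]
              apply Finset.sum_congr rfl
              intro n _
              rw [lintegral_indicator_const (hA n), ENNReal.ofReal_mul (hw n), ofReal_measureReal]
          _ = ∫⁻ x, ∑ n ∈ Finset.range N, (A n).indicator (fun _ => ENNReal.ofReal (w n)) x ∂μ :=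
              (lintegral_finsetSum _ (fun n _ => hmi n)).symm
          _ ≤ ∫⁻ x, (K + B.indicator (fun _ => ENNReal.ofReal V) x) ∂μ := by
              apply lintegral_mono
              intro x
              by_cases hx : x ∈ B
              · simp only [indicator_of_mem hx]
                refine le_trans ?_ le_add_self
                rw [hV, ENNReal.ofReal_sum_of_nonneg (fun n _ => hw n)]
                exact Finset.sum_le_sum fun n _ => indicator_le_self _ _ _
              · simp only [indicator_of_notMem hx, add_zero]
                exact (ENNReal.sum_le_tsum _).trans (not_lt.1 hx)
          _ = K * μ univ + ENNReal.ofReal V * μ B := by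
              rw [lintegral_add_left measurable_const, lintegral_const,
                lintegral_indicator_const (hgt K)]
          _ ≤ K * 1 + ENNReal.ofReal V * μ B := by gcongr
          _ = _ := by
              rw [ENNReal.ofReal_add (by positivity) (by positivity), ENNReal.ofReal_mul hV0,
                ofReal_measureReal]
              simp
      have e2 := (ENNReal.ofReal_le_ofReal_iff (by positivity)).1 e1
      linarith
    have ht := (not_summable_iff_tendsto_nat_atTop_of_nonneg hw).1 hs
    have ht2 := ht.const_mul_atTop (sub_pos.2 hlt)
    obtain ⟨N, hN⟩ := (ht2.eventually_gt_atTop (K : ℝ)).exists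
    exact absurd (hb N) (not_le.2 hN)
  have hset : {x | F x = ⊤} = ⋂ K : ℕ, {x | (K : ℝ≥0∞) < F x} := by
    ext x
    simp only [mem_ofPred_eq, mem_iInter]
    constructor
    · intro h K; rw [h]; exact ENNReal.natCast_lt_top K
    · intro h
      by_contra hne
      obtain ⟨K, hK⟩ := ENNReal.exists_nat_gt hne
      exact lt_asymm hK (h K)
  refine ⟨hFm (measurableSet_singleton ⊤), ?_⟩
  rw [hset]
  have hanti : Antitone fun K : ℕ => {x | (K : ℝ≥0∞) < F x} := by
    intro a b hab x hx
    have h1 : (b : ℝ≥0∞) < F x := hx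
    have h2 : (a : ℝ≥0∞) ≤ b := by exact_mod_cast hab
    exact lt_of_le_of_lt h2 h1
  refine ge_of_tendsto' (tendsto_measure_iInter_atTop (fun K => (hgt K).nullMeasurableSet) hanti
    ⟨0, measure_ne_top _ _⟩) (fun K => ?_)
  exact (ENNReal.ofReal_le_iff_le_toReal (measure_ne_top _ _)).2 (key K)

lemma not_summable_w : ¬ Summable (fun n : ℕ => 1 / ((n : ℝ) * Real.log n)) := by
  intro h
  have h1 := (summable_nat_add_iff 1).2 h
  rw [← summable_condensed_iff_of_nonneg] at h1
  · have h2 : Summable fun k : ℕ => (1 / (2 * Real.log 2)) * (1 / ((k + 1 : ℕ) : ℝ)) := by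
      refine Summable.of_nonneg_of_le (fun k => ?_) (fun k => ?_) h1
      · have := Real.log_pos one_lt_two
        positivity
      · push_cast
        have hl2 := Real.log_pos one_lt_two
        have q : (1:ℝ) ≤ 2 ^ k := one_le_pow₀ one_le_two
        have q1 : (2:ℝ) ^ k + 1 ≤ 2 ^ (k + 1) := by rw [pow_succ]; linarith
        have q2 : Real.log ((2:ℝ) ^ k + 1) ≤ (k + 1) * Real.log 2 := by
          have := Real.log_le_log (by positivity) q1
          rw [Real.log_pow] at this
          push_cast at this
          exact this
        have q3 : 0 < Real.log ((2:ℝ) ^ k + 1) := Real.log_pos (by linarith)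
        have q4 : ((2:ℝ) ^ k + 1) * Real.log ((2:ℝ) ^ k + 1)
            ≤ 2 ^ (k + 1) * ((k + 1) * Real.log 2) := by gcongr
        calc _ = (2:ℝ) ^ k * (1 / (2 ^ (k + 1) * ((k + 1) * Real.log 2))) := by
              rw [pow_succ]; field_simp
          _ ≤ _ := by gcongr
    have hl2 := Real.log_pos one_lt_two
    rw [summable_mul_left_iff (by positivity)] at h2
    exact Real.not_summable_one_div_natCast ((summable_nat_add_iff 1).1 h2)
  · intro n
    have : 0 ≤ Real.log ((n + 1 : ℕ) : ℝ) := Real.log_natCast_nonneg _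
    positivity
  · intro m n hm hmn
    have h1 : (1:ℝ) < ((m + 1 : ℕ) : ℝ) := by exact_mod_cast Nat.lt_add_of_pos_left hm
    have h2 : ((m + 1 : ℕ) : ℝ) ≤ ((n + 1 : ℕ) : ℝ) := by exact_mod_cast Nat.add_le_add_right hmn 1
    have h3 := Real.log_pos h1
    have h4 := Real.log_le_log (by linarith) h2
    apply one_div_le_one_div_of_le (by positivity)
    gcongr

theorem stmt11 : ∃ S : Set ℝ, MeasurableSet S ∧ S ⊆ Set.Ioo (0:ℝ) 1 ∧
    ENNReal.ofReal (1 / 40) ≤ volume S ∧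
    ∀ α ∈ S, Tendsto (fun N => ∑ n ∈ Finset.Icc 2 N,
        Set.indicator (Wset n) (fun _ => 1 / ((n : ℝ) * Real.log n)) α)
      atTop atTop := by
  set w : ℕ → ℝ := fun n => 1 / ((n : ℝ) * Real.log n) with hw
  have hw0 : ∀ n, 0 ≤ w n := fun n => by
    have := Real.log_natCast_nonneg n
    simp only [hw]
    positivity
  obtain ⟨hm, hv⟩ := diverge_lemma nuG nuG_le_one (fun n => Wset (n + 10)) (fun n => Wset_meas _)
    (fun n => w (n + 10)) (fun n => hw0 _)
    (fun h => not_summable_w ((summable_nat_add_iff 10).1 h)) (1 / 5) (by norm_num)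
    (fun n => nuG_W _ (by omega))
  set E := {x | ∑' n, (Wset (n + 10)).indicator (fun _ => ENNReal.ofReal (w (n + 10))) x = ⊤}
    with hE
  refine ⟨E ∩ Ioo 0 1, hm.inter measurableSet_Ioo, inter_subset_right, ?_, ?_⟩
  · rw [← Measure.restrict_apply hm]
    refine le_trans ?_ (hv.trans (nuG_le E))
    apply ENNReal.ofReal_le_ofReal
    norm_num
  · intro α hα
    have hns : ¬ Summable (fun n => (Wset n).indicator (fun _ => w n) α) := by
      intro h
      have h2 := ((summable_nat_add_iff 10).2 h).tsum_ofReal_ne_top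
      apply h2
      have h3 : ∑' n, (Wset (n + 10)).indicator (fun _ => ENNReal.ofReal (w (n + 10))) α = ⊤ := hα.1
      rw [← h3]
      congr 1
      ext n
      by_cases hx : α ∈ Wset (n + 10) <;> simp [hx]
    rw [not_summable_iff_tendsto_nat_atTop_of_nonneg
      (fun n => indicator_nonneg (fun _ _ => hw0 n) _)] at hns
    refine (hns.comp (tendsto_add_atTop_nat 1)).congr (fun N => ?_)
    simp only [Function.comp]
    symm
    apply Finset.sum_subset
    · intro n hn
      simp only [Finset.mem_Icc, Finset.mem_range] at hn ⊢
      omega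
    · intro n hn hn2
      simp only [Finset.mem_Icc, Finset.mem_range] at hn hn2
      have : n = 0 ∨ n = 1 := by omega
      rcases this with rfl | rfl <;> simp [hw]
end

section
/- Let α ∈ (0,1) be irrational with continued fraction partial quotients (a_n) and convergent denominators (q_n). Then for every x ∈ [0,1) and every n ≥ 1: Σ_{j=1}^{q_n} χ_{V_j}(x) ≤ Σ_{i=1}^{n} a_i. -/
open MeasureTheory Filter Set

noncomputable def rot (α : ℝ) : ℝ → ℝ := fun x => Int.fract (x + α)

/-- The denominators of the convergents. -/
noncomputable def cfQ (α : ℝ) : ℕ → ℕ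
  | 0 => 1
  | 1 => cfA α 1
  | n + 2 => cfA α (n + 2) * cfQ α (n + 1) + cfQ α n

/-- The coding of the orbit of `x` under the rotation by `α`. -/
noncomputable def code (α x : ℝ) (i : ℕ) : ℕ :=
  if (rot α)^[i] x < α then 0 else 1

/-- The set of points of `[0,1)` that are undetermined at step `j`. -/
def undet (α : ℝ) (j : ℕ) : Set ℝ :=
  {x ∈ Set.Ico (0:ℝ) 1 | ∃ y ∈ Set.Ico (0:ℝ) 1,
    (∀ i ≤ j, code α y i = code α x i) ∧ code α y (j + 1) ≠ code α x (j + 1)}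


/-- numerators of the convergents -/
noncomputable def cfP (α : ℝ) : ℕ → ℤ
  | 0 => 0
  | 1 => 1
  | n + 2 => (cfA α (n + 2) : ℤ) * cfP α (n + 1) + cfP α n

lemma gauss_irr {x : ℝ} (h : Irrational x) : Irrational (gaussMap x) := by
  unfold gaussMap Int.fract
  have h1 : Irrational (1 / x) := by simpa using h.inv
  exact h1.sub_intCast _

lemma gauss_mem {x : ℝ} (h : Irrational x) : gaussMap x ∈ Ioo (0:ℝ) 1 := by
  have h1 := (gauss_irr h).ne_zero
  refine ⟨lt_of_le_of_ne (Int.fract_nonneg _) (Ne.symm h1), Int.fract_lt_one _⟩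

lemma gauss_iter {α : ℝ} (hα : α ∈ Ioo (0:ℝ) 1) (h : Irrational α) (n : ℕ) :
    gaussMap^[n] α ∈ Ioo (0:ℝ) 1 ∧ Irrational (gaussMap^[n] α) := by
  induction n with
  | zero => exact ⟨hα, h⟩
  | succ n ih =>
    rw [Function.iterate_succ_apply']
    exact ⟨gauss_mem ih.2, gauss_irr ih.2⟩

lemma cfA_eq {α : ℝ} (hα : α ∈ Ioo (0:ℝ) 1) (h : Irrational α) (n : ℕ) :
    (cfA α (n+1) : ℝ) = 1 / (gaussMap^[n] α) - gaussMap^[n+1] α := by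
  obtain ⟨⟨h0, h1⟩, -⟩ := gauss_iter hα h n
  rw [Function.iterate_succ_apply']
  unfold cfA gaussMap
  rw [Nat.add_sub_cancel, natCast_floor_eq_intCast_floor (by positivity)]
  unfold Int.fract
  simp

lemma cfA_pos {α : ℝ} (hα : α ∈ Ioo (0:ℝ) 1) (h : Irrational α) (n : ℕ) :
    1 ≤ cfA α (n+1) := by
  obtain ⟨⟨h0, h1⟩, -⟩ := gauss_iter hα h n
  unfold cfA
  rw [Nat.add_sub_cancel, Nat.one_le_floor_iff, le_div_iff₀ h0]
  linarith

lemma cfE {α : ℝ} (hα : α ∈ Ioo (0:ℝ) 1) (h : Irrational α) (n : ℕ) :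
    (cfQ α (n+1) : ℝ) * α - cfP α (n+1) = - gaussMap^[n+1] α * ((cfQ α n : ℝ) * α - cfP α n) := by
  induction n with
  | zero =>
    have h1 := cfA_eq hα h 0
    have h0 : α ≠ 0 := h.ne_zero
    simp [cfQ, cfP] at h1 ⊢
    rw [h1]
    field_simp
    ring
  | succ n ih =>
    have h1 := cfA_eq hα h (n+1)
    obtain ⟨⟨h0, -⟩, -⟩ := gauss_iter hα h (n+1)
    have e : (cfQ α (n+1+1) : ℝ) * α - cfP α (n+1+1) =
      cfA α (n+1+1) * ((cfQ α (n+1) : ℝ) * α - cfP α (n+1)) + ((cfQ α n : ℝ) * α - cfP α n) := by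
      simp only [cfQ, cfP]; push_cast; ring
    rw [e, h1, ih]
    field_simp
    ring

lemma cfE_ne {α : ℝ} (hα : α ∈ Ioo (0:ℝ) 1) (h : Irrational α) (n : ℕ) :
    (cfQ α n : ℝ) * α - cfP α n ≠ 0 := by
  induction n with
  | zero => simpa [cfQ, cfP] using h.ne_zero
  | succ n ih =>
    rw [cfE hα h]
    obtain ⟨⟨h0, -⟩, -⟩ := gauss_iter hα h (n+1)
    exact mul_ne_zero (by linarith) ih

lemma cfDet (α : ℝ) (n : ℕ) :
    ((cfQ α (n+1) : ℤ) * cfP α n - cfP α (n+1) * cfQ α n)^2 = 1 := by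
  induction n with
  | zero => simp [cfQ, cfP]
  | succ n ih =>
    rw [← ih]
    simp only [cfQ, cfP]; push_cast; ring

lemma cfQ_pos {α : ℝ} (hα : α ∈ Ioo (0:ℝ) 1) (h : Irrational α) (n : ℕ) :
    1 ≤ cfQ α n ∧ cfQ α n ≤ cfQ α (n+1) := by
  induction n with
  | zero => exact ⟨le_rfl, cfA_pos hα h 0⟩
  | succ n ih =>
    refine ⟨ih.1.trans ih.2, ?_⟩
    have := cfA_pos hα h (n+1)
    simp only [cfQ]
    nlinarith [ih.1]

/-- best approximation -/
lemma best {α : ℝ} {q p q' p' : ℤ} (hdet : (q * p' - p * q')^2 = 1)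
    (hq' : 0 < q') (hq : 0 < q)
    (he : (q * α - p) * (q' * α - p') < 0)
    {k t : ℤ} (hk : 0 < k) (hkq : k < q) : |(q':ℝ) * α - p'| ≤ |k * α - t| := by
  obtain ⟨D, hD⟩ : ∃ D, D = q * p' - p * q' := ⟨_, rfl⟩
  obtain ⟨u, hu⟩ : ∃ u, u = D * (k * p' - t * q') := ⟨_, rfl⟩
  obtain ⟨v, hv⟩ : ∃ v, v = D * (q * t - p * k) := ⟨_, rfl⟩
  rw [← hD] at hdet
  have hk1 : k = u * q + v * q' := by
    have : k = D^2 * k := by rw [hdet]; ring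
    rw [this, hu, hv, pow_two]; nth_rw 2 [hD]; ring
  have ht1 : t = u * p + v * p' := by
    have : t = D^2 * t := by rw [hdet]; ring
    rw [this, hu, hv, pow_two]; nth_rw 2 [hD]; ring
  have hv0 : v ≠ 0 := by
    intro h0
    rw [h0] at hk1
    have : 0 < u := by by_contra hc; nlinarith
    nlinarith
  have huv : u * v ≤ 0 := by
    by_contra hc
    push Not at hc
    rcases pos_and_pos_or_neg_and_neg_of_mul_pos hc with ⟨h1, h2⟩ | ⟨h1, h2⟩ <;> nlinarith
  have e : (k:ℝ) * α - t = u * (q * α - p) + v * (q' * α - p') := by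
    rw [hk1, ht1]; push_cast; ring
  rw [e]
  generalize (q:ℝ) * α - p = a at *
  generalize (q':ℝ) * α - p' = b at *
  have huvR : (u:ℝ) * v ≤ 0 := by exact_mod_cast huv
  have hvR : (1:ℝ) ≤ (v:ℝ)^2 := by
    have : 0 < v^2 := by positivity
    exact_mod_cast this
  apply sq_le_sq.1
  nlinarith [mul_nonneg_of_nonpos_of_nonpos huvR he.le, sq_nonneg ((u:ℝ) * a), sq_nonneg b]

/-- geometric core -/
lemma core {α : ℝ} {q p q' p' : ℤ} (hdet : (q * p' - p * q')^2 = 1)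
    (hq' : 0 < q') (hqq : q' ≤ q)
    (he : (q * α - p) * (q' * α - p') < 0) (hlt : |q * α - p| < |q' * α - p'|)
    {A B : ℝ} {j j' : ℤ} (hj : q ≤ j + 2) (hjj : j < j') (hjq : j' - j < q)
    (hno : ∀ k t : ℤ, -1 ≤ k → k ≤ j → ¬ (A < t - k * α ∧ t - k * α ≤ B))
    {t t' : ℤ} (h1 : A < t - (j+1) * α) (h2 : t - (j+1) * α ≤ B)
    (h1' : A < t' - (j'+1) * α) (h2' : t' - (j'+1) * α ≤ B) : False := by
  have hb := best (t := t' - t) hdet hq' (hq'.trans_le hqq) he (sub_pos.2 hjj) hjq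
  have n1 := hno (j + 1 - q') (t - p') (by omega) (by omega)
  have n2 := hno (j + 1 - q) (t - p) (by omega) (by omega)
  push_cast at hb n1 n2
  have r1 : (t:ℝ) - p' - (j + 1 - q') * α = t - (j+1) * α + (q' * α - p') := by ring
  have r2 : (t:ℝ) - p - (j + 1 - q) * α = t - (j+1) * α + (q * α - p) := by ring
  have r3 : ((j':ℝ) - j) * α - (t' - t) = (t - (j+1) * α) - (t' - (j'+1) * α) := by ring
  rw [r1] at n1
  rw [r2] at n2
  rw [r3] at hb
  generalize (q:ℝ) * α - p = a at *
  generalize (q':ℝ) * α - p' = b at *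
  generalize (t:ℝ) - (j+1) * α = P at *
  generalize (t':ℝ) - (j'+1) * α = P' at *
  rcases mul_neg_iff.1 he with ⟨ha, hb'⟩ | ⟨ha, hb'⟩
  · rw [abs_of_pos ha, abs_of_neg hb'] at hlt
    rw [abs_of_neg hb'] at hb
    rcases le_abs'.1 hb with h | h
    · exact n2 ⟨by linarith, by linarith⟩
    · exact n1 ⟨by linarith, by linarith⟩
  · rw [abs_of_neg ha, abs_of_pos hb'] at hlt
    rw [abs_of_pos hb'] at hb
    rcases le_abs'.1 hb with h | h
    · exact n1 ⟨by linarith, by linarith⟩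
    · exact n2 ⟨by linarith, by linarith⟩

lemma rot_step {α u v : ℝ} (hα : α ∈ Ioo (0:ℝ) 1) (hu : 0 ≤ u) (huv : u < v) (hv : v < 1) :
    (∃ m : ℤ, rot α u = u + α - m ∧ rot α v = v + α - m ∧
      (rot α u < α ↔ rot α v < α)) ∨
    (u + α < 1 ∧ 1 ≤ v + α ∧ ¬ rot α u < α ∧ rot α v < α) := by
  obtain ⟨h0, h1⟩ := hα
  have w0 : ∀ w : ℝ, 0 ≤ w → w + α < 1 → rot α w = w + α := fun w h h' => by
    unfold rot; exact Int.fract_eq_self.2 ⟨by linarith, h'⟩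
  have w1 : ∀ w : ℝ, w < 1 → 1 ≤ w + α → rot α w = w + α - 1 := fun w h h' => by
    unfold rot; rw [Int.fract_eq_iff]
    exact ⟨by linarith, by linarith, 1, by push_cast; ring⟩
  rcases lt_or_ge (u + α) 1 with hu1 | hu1 <;> rcases lt_or_ge (v + α) 1 with hv1 | hv1
  · left
    refine ⟨0, by rw [w0 u hu hu1]; simp, by rw [w0 v (by linarith) hv1]; simp, ?_⟩
    rw [w0 u hu hu1, w0 v (by linarith) hv1]
    constructor <;> intro <;> linarith
  · right
    refine ⟨hu1, hv1, ?_, ?_⟩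
    · rw [w0 u hu hu1]; linarith
    · rw [w1 v hv hv1]; linarith
  · linarith
  · left
    refine ⟨1, by rw [w1 u (by linarith) hu1]; simp, by rw [w1 v hv hv1]; simp, ?_⟩
    rw [w1 u (by linarith) hu1, w1 v hv hv1]
    constructor <;> intro <;> linarith

lemma code_eq_iff (α x y : ℝ) (i : ℕ) :
    code α y i = code α x i ↔ ((rot α)^[i] x < α ↔ (rot α)^[i] y < α) := by
  unfold code
  split_ifs with h1 h2 h2 <;> simp [h1, h2]

lemma rot_mem {α x : ℝ} (hx : x ∈ Ico (0:ℝ) 1) (i : ℕ) : (rot α)^[i] x ∈ Ico (0:ℝ) 1 := by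
  cases i with
  | zero => exact hx
  | succ i =>
    rw [Function.iterate_succ_apply']
    exact ⟨Int.fract_nonneg _, Int.fract_lt_one _⟩

lemma same_shift {α x y : ℝ} (hα : α ∈ Ioo (0:ℝ) 1) (hx : x ∈ Ico (0:ℝ) 1)
    (hy : y ∈ Ico (0:ℝ) 1) (hxy : x < y) (j : ℕ)
    (hc : ∀ i ≤ j, ((rot α)^[i] x < α ↔ (rot α)^[i] y < α)) :
    ∃ m : ℤ, (rot α)^[j] x = x + j * α - m ∧ (rot α)^[j] y = y + j * α - m := by
  induction j with
  | zero => exact ⟨0, by simp, by simp⟩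
  | succ j ih =>
    obtain ⟨m, h1, h2⟩ := ih (fun i hi => hc i (by omega))
    have hcj := hc (j+1) le_rfl
    rw [Function.iterate_succ_apply', Function.iterate_succ_apply'] at *
    rcases rot_step hα (rot_mem (α := α) hx j).1 (by rw [h1, h2]; linarith)
      (rot_mem (α := α) hy j).2 with ⟨m', e1, e2, -⟩ | ⟨-, -, e1, e2⟩
    · refine ⟨m + m', ?_, ?_⟩
      · rw [e1, h1]; push_cast; ring
      · rw [e2, h2]; push_cast; ring
    · exact absurd (hcj.2 e2) e1

/-- undetermined: interval description -/
lemma interval {α x y : ℝ} (hα : α ∈ Ioo (0:ℝ) 1) (hx : x ∈ Ico (0:ℝ) 1)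
    (hy : y ∈ Ico (0:ℝ) 1) (hxy : x < y) (j : ℕ)
    (hc : ∀ i ≤ j, ((rot α)^[i] x < α ↔ (rot α)^[i] y < α))
    (hd : ¬ ((rot α)^[j+1] x < α ↔ (rot α)^[j+1] y < α)) :
    (∀ k t : ℤ, -1 ≤ k → k ≤ j → ¬ (x < t - k * α ∧ t - k * α ≤ y)) ∧
    ∃ t : ℤ, x < t - (j+1) * α ∧ t - (j+1) * α ≤ y := by
  constructor
  · rintro k t hk hkj ⟨h1, h2⟩
    rcases eq_or_lt_of_le hk with rfl | hk
    · have h0 := hc 0 (by omega)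
      simp only [Function.iterate_zero, id] at h0
      push_cast at h1 h2
      obtain ⟨a0, a1⟩ := hα
      obtain ⟨x0, x1⟩ := hx
      obtain ⟨y0, y1⟩ := hy
      have l1 : (-1:ℤ) < t := by
        have : ((-1:ℤ):ℝ) < t := by push_cast; linarith
        exact_mod_cast this
      have l2 : t < 1 := by
        have : (t:ℝ) < (1:ℤ) := by push_cast; linarith
        exact_mod_cast this
      have : t = 0 := by omega
      subst this
      push_cast at h1 h2
      have := h0.1 (by linarith)
      linarith
    · obtain ⟨i, rfl⟩ := Int.eq_ofNat_of_zero_le (show 0 ≤ k by omega)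
      obtain ⟨m, e1, e2⟩ := same_shift hα hx hy hxy i (fun l hl => hc l (by omega))
      have b1 := (rot_mem (α := α) hx i).1
      have b2 := (rot_mem (α := α) hy i).2
      rw [e1] at b1
      rw [e2] at b2
      push_cast at h1 h2
      have l1 : (m:ℝ) < t := by linarith
      have l2 : (t:ℝ) < (m+1 : ℤ) := by push_cast; linarith
      have l1' : m < t := by exact_mod_cast l1
      have l2' : t < m + 1 := by exact_mod_cast l2
      omega
  · obtain ⟨m, h1, h2⟩ := same_shift hα hx hy hxy j hc
    rw [Function.iterate_succ_apply', Function.iterate_succ_apply'] at hd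
    rcases rot_step hα (rot_mem (α := α) hx j).1 (by rw [h1, h2]; linarith)
      (rot_mem (α := α) hy j).2 with ⟨m', -, -, e⟩ | ⟨e1, e2, -, -⟩
    · exact absurd e hd
    · rw [h1] at e1
      rw [h2] at e2
      exact ⟨m + 1, by push_cast; linarith, by push_cast; linarith⟩

lemma undet_interval {α x : ℝ} (hα : α ∈ Ioo (0:ℝ) 1) {j : ℕ} (h : x ∈ undet α j) :
    ∃ A B : ℝ, A ≤ x ∧ x ≤ B ∧
    (∀ k t : ℤ, -1 ≤ k → k ≤ j → ¬ (A < t - k * α ∧ t - k * α ≤ B)) ∧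
    ∃ t : ℤ, A < t - (j+1) * α ∧ t - (j+1) * α ≤ B := by
  obtain ⟨hx, y, hy, hc, hd⟩ := h
  rw [Ne, code_eq_iff] at hd
  simp only [code_eq_iff] at hc
  rcases lt_trichotomy x y with hl | rfl | hl
  · exact ⟨x, y, le_rfl, hl.le, interval hα hx hy hl j hc hd⟩
  · exact absurd Iff.rfl hd
  · exact ⟨y, x, hl.le, le_rfl, interval hα hy hx hl j (fun i hi => (hc i hi).symm)
      (fun hh => hd hh.symm)⟩

lemma undet_sep {α : ℝ} (hα : α ∈ Ioo (0:ℝ) 1) (hirr : Irrational α) {x : ℝ} (n : ℕ)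
    {j j' : ℕ} (hj : cfQ α (n+1) ≤ j + 2) (hjj : j < j') (hjq : j' < j + cfQ α (n+1))
    (h : x ∈ undet α j) (h' : x ∈ undet α j') : False := by
  obtain ⟨A, B, hA, hB, hno, t, t1, t2⟩ := undet_interval hα h
  obtain ⟨A', B', hA', hB', hno', t', t1', t2'⟩ := undet_interval hα h'
  have hE := cfE hα hirr n
  have hne := cfE_ne hα hirr n
  obtain ⟨⟨g0, g1⟩, -⟩ := gauss_iter hα hirr (n+1)
  obtain ⟨hq1, hq2⟩ := cfQ_pos hα hirr n
  refine core (α := α) (q := cfQ α (n+1)) (p := cfP α (n+1)) (q' := cfQ α n) (p' := cfP α n)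
    (A := min A A') (B := max B B') (j := j) (j' := j') (t := t) (t' := t')
    (cfDet α n) (by omega) (by omega) ?_ ?_ (by omega) (by omega) (by omega) ?_ ?_ ?_ ?_ ?_
  · push_cast
    rw [hE]
    have := pow_pos (abs_pos.2 hne) 2
    rw [sq_abs] at this
    nlinarith
  · push_cast
    rw [hE, abs_mul, abs_neg, abs_of_pos g0]
    have := abs_pos.2 hne
    nlinarith
  · rintro k s hk hkj ⟨h1, h2⟩
    have n1 := hno k s hk hkj
    have n2 := hno' k s hk (by omega)
    rcases min_lt_iff.1 h1 with h1 | h1 <;> rcases le_max_iff.1 h2 with h2 | h2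
    · exact n1 ⟨h1, h2⟩
    · rcases le_or_gt ((s:ℝ) - k * α) B with h3 | h3
      · exact n1 ⟨h1, h3⟩
      · exact n2 ⟨by linarith, h2⟩
    · rcases le_or_gt ((s:ℝ) - k * α) B' with h3 | h3
      · exact n2 ⟨h1, h3⟩
      · exact n1 ⟨by linarith, h2⟩
    · exact n2 ⟨h1, h2⟩
  · push_cast; exact (min_le_left _ _).trans_lt t1
  · push_cast; exact t2.trans (le_max_left _ _)
  · push_cast; exact (min_le_right _ _).trans_lt t1'
  · push_cast; exact t2'.trans (le_max_right _ _)

/-- sums over blocks -/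
lemma block {g : ℕ → ℕ} (hg : ∀ k, g k ≤ 1) (s q a : ℕ)
    (hsep : ∀ k k', s ≤ k → k < k' → k' < k + q → g k ≠ 0 → g k' ≠ 0 → False) :
    ∑ k ∈ Finset.range (s + a * q), g k ≤ ∑ k ∈ Finset.range s, g k + a := by
  induction a with
  | zero => simp
  | succ a ih =>
    have : s + (a+1) * q = s + a * q + q := by ring
    rw [this, Finset.sum_range_add]
    have h1 : ∑ i ∈ Finset.range q, g (s + a * q + i) ≤ 1 := by
      by_cases h : ∃ i ∈ Finset.range q, g (s + a * q + i) ≠ 0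
      · obtain ⟨i, hi, hne⟩ := h
        rw [Finset.sum_eq_single_of_mem i hi]
        · exact hg _
        · intro b hb hbi
          by_contra hc
          simp only [Finset.mem_range] at hi hb
          rcases lt_or_gt_of_ne hbi with h | h
          · exact hsep (s + a*q + b) (s + a*q + i) (by omega) (by omega) (by omega) hc hne
          · exact hsep (s + a*q + i) (s + a*q + b) (by omega) (by omega) (by omega) hne hc
      · push Not at h
        rw [Finset.sum_eq_zero h]; omega
    omega

lemma sum_triv {g : ℕ → ℕ} (hg : ∀ k, g k ≤ 1) (h0 : ∀ k < 3, g k = 0) (m : ℕ) :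
    ∑ k ∈ Finset.range (m + 3), g k ≤ m := by
  induction m with
  | zero => rw [Finset.sum_eq_zero]; intro k hk; exact h0 k (by simpa using hk)
  | succ m ih =>
    rw [show m + 1 + 3 = (m + 3) + 1 by ring, Finset.sum_range_succ]
    have := hg (m+3)
    omega

lemma combi {g a q : ℕ → ℕ} (hg : ∀ k, g k ≤ 1) (h0 : ∀ k < 3, g k = 0)
    (ha : ∀ n, 1 ≤ a (n+1)) (hq0 : q 0 = 1) (hq1 : q 1 = a 1)
    (hq : ∀ n, q (n+2) = a (n+2) * q (n+1) + q n)
    (hsep : ∀ n k k', q (n+1) ≤ k → k < k' → k' < k + q (n+1) → g k ≠ 0 → g k' ≠ 0 → False)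
    (n : ℕ) :
    ∑ k ∈ Finset.range (q (n+1) + 3), g k ≤ ∑ i ∈ Finset.Icc 1 (n+1), a i := by
  have step : ∀ n, ∑ k ∈ Finset.range (q (n+2) + q (n+1)), g k ≤
      ∑ k ∈ Finset.range (q (n+1) + q n), g k + a (n+2) := by
    intro n
    have := block hg (q (n+1) + q n) (q (n+1)) (a (n+2))
      (fun k k' h => hsep n k k' (by omega))
    rwa [show q (n+1) + q n + a (n+2) * q (n+1) = q (n+2) + q (n+1) by rw [hq]; ring] at this
  have main : ∀ n, ∑ k ∈ Finset.range (q (n+2) + q (n+1)), g k + 2 ≤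
      ∑ i ∈ Finset.Icc 1 (n+2), a i := by
    intro n
    induction n with
    | zero =>
      rw [Finset.sum_Icc_succ_top (by omega)]
      simp only [zero_add, Finset.Icc_self, Finset.sum_singleton, Nat.reduceAdd]
      have a1 := ha 0
      have a2 := ha 1
      simp only [zero_add, Nat.reduceAdd] at a1 a2
      by_cases h : a 1 = 1
      · have := sum_triv hg h0 (a 2 - 1)
        have e := hq 0
        simp only [zero_add] at e
        rw [hq1, hq0, h] at e
        rw [e, hq1, h, show a 2 * 1 + 1 + 1 = a 2 - 1 + 3 by omega]
        omega
      · have h1 := step 0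
        simp only [zero_add] at h1
        have := sum_triv hg h0 (a 1 - 2)
        rw [show a 1 - 2 + 3 = q 1 + q 0 by rw [hq1, hq0]; omega] at this
        omega
    | succ n ih =>
      rw [Finset.sum_Icc_succ_top (by omega)]
      have := step (n+1)
      simp only [show n + 1 + 2 = n + 2 + 1 from rfl, show n + 1 + 1 = n + 2 from rfl] at *
      omega
  cases n with
  | zero =>
    have := sum_triv hg h0 (q 1)
    simpa [hq1] using this
  | succ n =>
    have h1 := main n
    have hqp : ∀ n, 1 ≤ q n ∧ 1 ≤ q (n+1) := by
      intro n
      induction n with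
      | zero => exact ⟨hq0.ge, by rw [hq1]; exact ha 0⟩
      | succ n ih => exact ⟨ih.2, by rw [hq]; omega⟩
    have h2 : ∑ k ∈ Finset.range (q (n+2) + 3), g k ≤
        ∑ k ∈ Finset.range (q (n+2) + q (n+1) + 2), g k :=
      Finset.sum_le_sum_of_subset (Finset.range_mono (by have := (hqp n).2; omega))
    rw [Finset.sum_range_succ _ (q (n+2) + q (n+1) + 1), Finset.sum_range_succ _ (q (n+2) + q (n+1))] at h2
    have h3 := hg (q (n+2) + q (n+1))
    have h4 := hg (q (n+2) + q (n+1) + 1)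
    change ∑ k ∈ Finset.range (q (n+2) + 3), g k ≤ ∑ i ∈ Finset.Icc 1 (n+2), a i
    omega

theorem stmt18 (α : ℝ) (hα : α ∈ Set.Ioo (0:ℝ) 1) (hirr : Irrational α)
    (x : ℝ) (hx : x ∈ Set.Ico (0:ℝ) 1) (n : ℕ) (hn : 1 ≤ n) :
    (∑ j ∈ Finset.Icc 1 (cfQ α n), Set.indicator (undet α j) (fun _ => (1:ℝ)) x)
      ≤ ∑ i ∈ Finset.Icc 1 n, (cfA α i : ℝ) := by
  classical
  obtain ⟨n, rfl⟩ : ∃ m, n = m + 1 := ⟨n - 1, by omega⟩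
  let g : ℕ → ℕ := fun k => if 3 ≤ k ∧ x ∈ undet α (k - 2) then 1 else 0
  have key := combi (g := g) (a := cfA α) (q := cfQ α)
    (fun k => by simp only [g]; split_ifs <;> omega)
    (fun k hk => by simp only [g]; rw [if_neg]; omega)
    (cfA_pos hα hirr) rfl rfl (fun _ => rfl)
    (fun m k k' h1 h2 h3 h4 h5 => by
      simp only [g, ne_eq, ite_eq_right_iff, one_ne_zero, imp_false, not_not] at h4 h5
      exact undet_sep hα hirr m (j := k - 2) (j' := k' - 2) (by omega) (by omega) (by omega)
        h4.2 h5.2) n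
  have e : ∀ m : ℕ, ∑ j ∈ Finset.Icc 1 m, Set.indicator (undet α j) (fun _ => (1:ℝ)) x
      = ((∑ k ∈ Finset.range (m + 3), g k : ℕ) : ℝ) := by
    intro m
    induction m with
    | zero =>
      have h3 : ∑ k ∈ Finset.range (0 + 3), g k = 0 :=
        Finset.sum_eq_zero (fun k hk => by
          have hk' : k < 3 := by simpa using hk
          simp only [g]; rw [if_neg]; omega)
      rw [h3]; simp
    | succ m ih =>
      rw [Finset.sum_Icc_succ_top (by omega), ih, show m + 1 + 3 = m + 3 + 1 by ring,
        Finset.sum_range_succ _ (m+3)]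
      push_cast
      congr 1
      simp [g, Set.indicator_apply]
  rw [e]
  exact_mod_cast key
end
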